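/- Let G be a finitely generated residually finite group, P ⊆ ν(G) with ⋂_{N∈P} N = {e_G}, and K a finite-index subgroup of G (with any finite generating set, giving word balls B_K). Then RF_{K,P∩K,B_K} ⪯ RF_{G,P,B_G}. If moreover every N ∈ P satisfies N ⊆ K, then RF_{K,P∩K,B_K} ≈ RF_{G,P,B_G}. -/

import Mathlib

/-- The word ball of radius `r` in a group `G` with respect to a finite (generating)
set `S`: products of at most `r` elements of `S ∪ S⁻¹`. -/
def wordBall {G : Type*} [Group G] (S : Finset G) (r : ℝ) : Set G :=
  {g | ∃ l : List G, (∀ x ∈ l, x ∈ S ∨ x⁻¹ ∈ S) ∧ (l.length : ℝ) ≤ r ∧ l.prod = g}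

/-- `ν(G)`: the set of finite-index normal subgroups of `G`. -/
def nu (G : Type*) [Group G] : Set (Subgroup G) :=
  {N | N.Normal ∧ N.FiniteIndex}

/-- The divisibility function `D_{G,P}(g) = min {[G:N] : N ∈ P, g ∉ N}`, with value `∞`
when no such `N` exists (in particular at `g = 1`). -/
noncomputable def divFn {G : Type*} [Group G] (P : Set (Subgroup G)) (g : G) : ℕ∞ :=
  sInf {n : ℕ∞ | ∃ N ∈ P, g ∉ N ∧ n = (N.index : ℕ∞)}

/-- The residual finiteness growth function
`RF_{G,P,B_G}(r) = max {D_{G,P}(g) : 1 ≠ g ∈ B_G(r)}` (as a real-valued function,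
taking the value `1` on an empty set of elements). -/
noncomputable def RFgrowth {G : Type*} [Group G] (P : Set (Subgroup G)) (S : Finset G)
    (r : ℝ) : ℝ :=
  sSup (insert 1 ((fun g => ((divFn P g).toNat : ℝ)) '' (wordBall S r \ {1})))

/-- `f ⪯ g`: there is `C > 0` with `f(r) ≤ C·g(C·r)` for all `r ≥ max {1, 1/C}`. -/
def GrowthLE (f g : ℝ → ℝ) : Prop :=
  ∃ C : ℝ, 0 < C ∧ ∀ r : ℝ, max 1 (1 / C) ≤ r → f r ≤ C * g (C * r)

/-- `f ≈ g`: `f ⪯ g` and `g ⪯ f`. -/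
def GrowthEquiv (f g : ℝ → ℝ) : Prop :=
  GrowthLE f g ∧ GrowthLE g f

theorem wordBall_mono {G : Type*} [Group G] (S : Finset G) {r t : ℝ} (h : r ≤ t) :
    wordBall S r ⊆ wordBall S t := by
  rintro g ⟨l, hl, hr, rfl⟩
  exact ⟨l, hl, hr.trans h, rfl⟩

theorem mul_mem_wordBall {G : Type*} [Group G] {S : Finset G} {r t : ℝ} {g h : G}
    (hg : g ∈ wordBall S r) (hh : h ∈ wordBall S t) : g * h ∈ wordBall S (r + t) := by
  obtain ⟨l, hl, hr, rfl⟩ := hg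
  obtain ⟨m, hm, ht, rfl⟩ := hh
  refine ⟨l ++ m, fun x hx => ?_, by push_cast [List.length_append]; linarith, by simp⟩
  rcases List.mem_append.1 hx with hx | hx
  exacts [hl x hx, hm x hx]

theorem inv_mem_wordBall {G : Type*} [Group G] {S : Finset G} {r : ℝ} {g : G}
    (hg : g ∈ wordBall S r) : g⁻¹ ∈ wordBall S r := by
  obtain ⟨l, hl, hr, rfl⟩ := hg
  refine ⟨(l.map (·⁻¹)).reverse, fun x hx => ?_, by simpa using hr,
    (List.prod_inv_reverse l).symm⟩
  obtain ⟨y, hy, rfl⟩ := List.mem_map.1 (List.mem_reverse.1 hx)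
  simpa [or_comm] using hl y hy

theorem one_mem_wordBall {G : Type*} [Group G] {S : Finset G} {r : ℝ} (hr : 0 ≤ r) :
    (1 : G) ∈ wordBall S r :=
  ⟨[], by simp, by simpa using hr, rfl⟩

theorem list_prod_mem_wordBall {G : Type*} [Group G] {S : Finset G} {c : ℝ} (l : List G)
    (h : ∀ x ∈ l, x ∈ wordBall S c) : l.prod ∈ wordBall S (c * l.length) := by
  induction l with
  | nil => exact one_mem_wordBall (by simp)
  | cons a l ih =>
    have := mul_mem_wordBall (h a (by simp)) (ih fun x hx => h x (by simp [hx]))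
    rw [List.prod_cons, List.length_cons]
    refine wordBall_mono S (le_of_eq ?_) this
    push_cast
    ring

theorem exists_mem_wordBall {G : Type*} [Group G] {S : Finset G}
    (hS : Subgroup.closure (S : Set G) = ⊤) (g : G) : ∃ n : ℕ, g ∈ wordBall S n := by
  have hg : g ∈ Subgroup.closure (S : Set G) := hS ▸ Subgroup.mem_top g
  induction hg using Subgroup.closure_induction with
  | mem x hx => exact ⟨1, [x], by simpa using Or.inl hx, by simp, by simp⟩
  | one => exact ⟨0, one_mem_wordBall (by simp)⟩
  | mul x y _ _ hx hy =>
    obtain ⟨m, hm⟩ := hx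
    obtain ⟨n, hn⟩ := hy
    exact ⟨m + n, by simpa using mul_mem_wordBall hm hn⟩
  | inv x _ hx => exact hx.imp fun _ => inv_mem_wordBall

theorem exists_subset_wordBall {G : Type*} [Group G] {S : Finset G}
    (hS : Subgroup.closure (S : Set G) = ⊤) {F : Set G} (hF : F.Finite) :
    ∃ n : ℕ, F ⊆ wordBall S n := by
  choose n hn using exists_mem_wordBall hS
  obtain ⟨b, hb⟩ := (hF.image n).bddAbove
  exact ⟨b, fun g hg => wordBall_mono S
    (Nat.cast_le.2 (hb (Set.mem_image_of_mem n hg))) (hn g)⟩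

theorem finite_mem_or_inv_mem {G : Type*} [Group G] (S : Finset G) :
    {x : G | x ∈ S ∨ x⁻¹ ∈ S}.Finite :=
  (S.finite_toSet.union S.finite_toSet.inv).subset fun _ hx => hx

theorem finite_wordBall {G : Type*} [Group G] (S : Finset G) (r : ℝ) :
    (wordBall S r).Finite := by
  have : Finite {x : G | x ∈ S ∨ x⁻¹ ∈ S} := finite_mem_or_inv_mem S
  refine ((List.finite_length_le {x : G | x ∈ S ∨ x⁻¹ ∈ S} ⌊r⌋₊).image
    fun l => (l.map Subtype.val).prod).subset ?_
  rintro g ⟨l, hl, hr, rfl⟩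
  lift l to List {x : G | x ∈ S ∨ x⁻¹ ∈ S} using hl
  exact ⟨l, Nat.le_floor (by simpa using hr), rfl⟩

/-- A homomorphism between finitely generated groups is Lipschitz for the word metrics. -/
theorem exists_map_mem_wordBall {H G : Type*} [Group H] [Group G] (f : H →* G)
    (T : Finset H) {S : Finset G} (hS : Subgroup.closure (S : Set G) = ⊤) :
    ∃ c : ℕ, ∀ r : ℝ, ∀ h ∈ wordBall T r, f h ∈ wordBall S (c * r) := by
  obtain ⟨c, hc⟩ := exists_subset_wordBall hS ((finite_mem_or_inv_mem T).image f)
  refine ⟨c, ?_⟩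
  rintro r _ ⟨l, hl, hr, rfl⟩
  rw [map_list_prod]
  refine wordBall_mono S ?_ (list_prod_mem_wordBall (c := c) (l.map f) fun x hx => ?_)
  · rw [List.length_map]
    gcongr
  · obtain ⟨y, hy, rfl⟩ := List.mem_map.1 hx
    exact hc ⟨y, hl y hy, rfl⟩

/-- A finite-index subgroup is undistorted: its word length is bounded linearly by that of the
ambient group. -/
theorem exists_mem_wordBall_of_finiteIndex {G : Type*} [Group G] (S : Finset G)
    (K : Subgroup G) [K.FiniteIndex] {T : Finset K}
    (hT : Subgroup.closure (T : Set K) = ⊤) :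
    ∃ c : ℕ, ∀ r : ℝ, 1 ≤ r → ∀ k : K, (k : G) ∈ wordBall S r → k ∈ wordBall T (c * r) := by
  let τ : G → G := fun g => (QuotientGroup.mk g : G ⧸ K).out
  have hτ (g : G) : (τ g)⁻¹ * g ∈ K := QuotientGroup.eq.1 (Quotient.out_eq' _)
  let κ : G → K := fun g => ⟨(τ g)⁻¹ * g, hτ g⟩
  have hstep : {k : K | ∃ x ∈ {x : G | x ∈ S ∨ x⁻¹ ∈ S}, ∃ g, k = κ (x * g) * (κ g)⁻¹}.Finite := by
    let φ : G × (G ⧸ K) × (G ⧸ K) → G := fun p => p.2.1.out⁻¹ * p.1 * p.2.2.out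
    refine Set.Finite.of_finite_image (f := Subtype.val) ?_ Subtype.val_injective.injOn
    refine (((finite_mem_or_inv_mem S).prod (Set.finite_univ (α := (G ⧸ K) × (G ⧸ K)))).image
      φ).subset ?_
    rintro _ ⟨k, ⟨x, hx, g, rfl⟩, rfl⟩
    refine ⟨(x, QuotientGroup.mk (x * g), QuotientGroup.mk g), ⟨hx, Set.mem_univ _⟩, ?_⟩
    simp only [φ, κ, τ, Subgroup.coe_mul, Subgroup.coe_inv]
    group
  obtain ⟨c, hc⟩ := exists_subset_wordBall hT (hstep.union (Set.finite_singleton (κ 1)))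
  have h1 : κ 1 ∈ wordBall T c := hc (Or.inr rfl)
  have hword (l : List G) (hl : ∀ x ∈ l, x ∈ S ∨ x⁻¹ ∈ S) :
      κ l.prod ∈ wordBall T (c * (l.length + 1)) := by
    induction l with
    | nil => simpa using h1
    | cons x l ih =>
      have hx : κ (x * l.prod) * (κ l.prod)⁻¹ ∈ wordBall T c :=
        hc (Or.inl ⟨x, hl x (by simp), _, rfl⟩)
      have := mul_mem_wordBall hx (ih fun y hy => hl y (by simp [hy]))
      rw [inv_mul_cancel_right] at this
      rw [List.prod_cons, List.length_cons]
      refine wordBall_mono T (le_of_eq ?_) this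
      push_cast
      ring
  refine ⟨3 * c, fun r hr k ⟨l, hl, hlr, hk⟩ => ?_⟩
  have hkκ : k = (κ 1)⁻¹ * κ l.prod := by
    have hτk : τ (k : G) = τ 1 :=
      congrArg Quotient.out (QuotientGroup.eq.2 (by simp) :
        (QuotientGroup.mk (k : G) : G ⧸ K) = QuotientGroup.mk 1)
    ext
    simp [κ, hk, hτk]
  rw [hkκ]
  refine wordBall_mono T ?_ (mul_mem_wordBall (inv_mem_wordBall h1) (hword l hl))
  push_cast
  nlinarith [(Nat.cast_nonneg c : (0 : ℝ) ≤ c)]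

theorem toNat_divFn_le {G : Type*} [Group G] {P : Set (Subgroup G)} {g : G} {N : Subgroup G}
    (hN : N ∈ P) (hg : g ∉ N) : (divFn P g).toNat ≤ N.index :=
  ENat.toNat_le_of_le_natCast (sInf_le ⟨N, hN, hg, rfl⟩)

theorem exists_toNat_divFn_eq {G : Type*} [Group G] {P : Set (Subgroup G)} {g : G}
    (h : ∃ N ∈ P, g ∉ N) : ∃ N ∈ P, g ∉ N ∧ (divFn P g).toNat = N.index := by
  obtain ⟨N, hN, hg⟩ := h
  obtain ⟨M, hM, hgM, hi⟩ :=
    csInf_mem (s := {n : ℕ∞ | ∃ N ∈ P, g ∉ N ∧ n = (N.index : ℕ∞)}) ⟨_, N, hN, hg, rfl⟩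
  exact ⟨M, hM, hgM, by rw [divFn, hi, ENat.toNat_natCast]⟩

theorem exists_notMem_of_sInf_eq_bot {G : Type*} [Group G] {P : Set (Subgroup G)}
    (hsep : sInf P = ⊥) {g : G} (hg : g ≠ 1) : ∃ N ∈ P, g ∉ N := by
  by_contra! h
  exact hg (Subgroup.mem_bot.1 (hsep ▸ Subgroup.mem_sInf.2 h))

theorem bddAbove_RFgrowth {G : Type*} [Group G] (P : Set (Subgroup G)) (S : Finset G) (r : ℝ) :
    BddAbove (insert 1 ((fun g => ((divFn P g).toNat : ℝ)) '' (wordBall S r \ {1}))) :=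
  ((((finite_wordBall S r).sdiff).image _).insert 1).bddAbove

theorem one_le_RFgrowth {G : Type*} [Group G] (P : Set (Subgroup G)) (S : Finset G) (r : ℝ) :
    1 ≤ RFgrowth P S r :=
  le_csSup (bddAbove_RFgrowth P S r) (Set.mem_insert _ _)

theorem toNat_divFn_le_RFgrowth {G : Type*} [Group G] (P : Set (Subgroup G)) {S : Finset G}
    {r : ℝ} {g : G} (hg : g ∈ wordBall S r) (h1 : g ≠ 1) :
    ((divFn P g).toNat : ℝ) ≤ RFgrowth P S r :=
  le_csSup (bddAbove_RFgrowth P S r) (Or.inr ⟨g, ⟨hg, h1⟩, rfl⟩)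

theorem RFgrowth_le {G : Type*} [Group G] {P : Set (Subgroup G)} {S : Finset G} {r M : ℝ}
    (hM : 1 ≤ M) (h : ∀ g ∈ wordBall S r, g ≠ 1 → ((divFn P g).toNat : ℝ) ≤ M) :
    RFgrowth P S r ≤ M := by
  refine csSup_le (Set.insert_nonempty _ _) ?_
  rintro _ (rfl | ⟨g, ⟨hg, h1⟩, rfl⟩)
  exacts [hM, h g hg h1]

theorem growthLE_RFgrowth_subgroupOf {G : Type*} [Group G] {S : Finset G}
    (hS : Subgroup.closure (S : Set G) = ⊤)
    {P : Set (Subgroup G)} (hP : P ⊆ nu G) (hsep : sInf P = ⊥)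
    (K : Subgroup G) (T : Finset K) :
    GrowthLE (RFgrowth ((fun N => N.subgroupOf K) '' P) T) (RFgrowth P S) := by
  obtain ⟨c, hc⟩ := exists_map_mem_wordBall K.subtype T hS
  refine ⟨c + 1, by positivity, fun r hr => ?_⟩
  have hr1 : 1 ≤ r := (le_max_left _ _).trans hr
  have hRF := one_le_RFgrowth P S ((c + 1) * r)
  have hle : RFgrowth P S ((c + 1) * r) ≤ (c + 1) * RFgrowth P S ((c + 1) * r) :=
    le_mul_of_one_le_left (by linarith) (by simp)
  refine (RFgrowth_le hRF fun k hk hk1 => ?_).trans hle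
  have hk1' : (k : G) ≠ 1 := by simpa using hk1
  obtain ⟨N, hN, hkN, hi⟩ := exists_toNat_divFn_eq (exists_notMem_of_sInf_eq_bot hsep hk1')
  have := (hP hN).2
  calc ((divFn ((fun N => N.subgroupOf K) '' P) k).toNat : ℝ)
      ≤ (N.subgroupOf K).index := by
        exact_mod_cast toNat_divFn_le (Set.mem_image_of_mem _ hN)
          (by simpa [Subgroup.mem_subgroupOf] using hkN)
    _ ≤ N.index := by
        exact_mod_cast Nat.le_of_dvd (Nat.pos_of_ne_zero this.index_ne_zero)
          (have := (hP hN).1; Subgroup.relIndex_dvd_index_of_normal N K)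
    _ = (divFn P (k : G)).toNat := by rw [hi]
    _ ≤ _ := toNat_divFn_le_RFgrowth P (wordBall_mono S (by nlinarith) (hc r k hk)) hk1'

theorem growthLE_RFgrowth_of_forall_le {G : Type*} [Group G] (S : Finset G)
    {P : Set (Subgroup G)} (hsep : sInf P = ⊥)
    (K : Subgroup G) [K.FiniteIndex] {T : Finset K}
    (hT : Subgroup.closure (T : Set K) = ⊤) (hPK : ∀ N ∈ P, N ≤ K) :
    GrowthLE (RFgrowth P S) (RFgrowth ((fun N => N.subgroupOf K) '' P) T) := by
  obtain ⟨c, hc⟩ := exists_mem_wordBall_of_finiteIndex S K hT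
  obtain ⟨b, hb⟩ : ∃ b : ℕ, ∀ g : G, g ∉ K → (divFn P g).toNat ≤ b := by
    rcases P.eq_empty_or_nonempty with rfl | ⟨N, hN⟩
    · refine ⟨0, fun g _ => ?_⟩
      simp [divFn]
    · exact ⟨N.index, fun g hg => toNat_divFn_le hN fun h => hg (hPK N hN h)⟩
  let C : ℝ := c + K.index + b + 1
  have hC : 1 ≤ C := by simp only [C]; linarith [(by positivity : (0 : ℝ) ≤ c + K.index + b)]
  refine ⟨C, by positivity, fun r hr => ?_⟩
  have hr1 : 1 ≤ r := (le_max_left _ _).trans hr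
  have hRF := one_le_RFgrowth ((fun N => N.subgroupOf K) '' P) T (C * r)
  refine RFgrowth_le (by nlinarith) fun g hg hg1 => ?_
  by_cases hgK : g ∈ K
  · lift g to K using hgK
    have hsepK : ∃ N ∈ (fun N => N.subgroupOf K) '' P, g ∉ N := by
      obtain ⟨N, hN, hgN⟩ := exists_notMem_of_sInf_eq_bot hsep hg1
      exact ⟨_, ⟨N, hN, rfl⟩, by simpa [Subgroup.mem_subgroupOf] using hgN⟩
    obtain ⟨_, ⟨N, hN, rfl⟩, hgN, hi⟩ := exists_toNat_divFn_eq hsepK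
    have hball : g ∈ wordBall T (C * r) := by
      refine wordBall_mono T ?_ (hc r hr1 g hg)
      gcongr
      simp only [C]
      linarith [(by positivity : (0 : ℝ) ≤ K.index + b)]
    calc ((divFn P (g : G)).toNat : ℝ) ≤ N.index := by
          exact_mod_cast toNat_divFn_le hN (by simpa [Subgroup.mem_subgroupOf] using hgN)
      _ = K.index * (N.subgroupOf K).index := by
          rw [← Subgroup.relIndex_mul_index (hPK N hN), Subgroup.relIndex]
          push_cast
          ring
      _ = K.index * (divFn ((fun N => N.subgroupOf K) '' P) g).toNat := by rw [hi]
      _ ≤ _ := by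
          gcongr
          · simp only [C]
            linarith [(by positivity : (0 : ℝ) ≤ c + b)]
          · exact toNat_divFn_le_RFgrowth _ hball (by simpa using hg1)
  · calc ((divFn P g).toNat : ℝ) ≤ b := by exact_mod_cast hb g hgK
      _ ≤ C := by
          simp only [C]
          linarith [(by positivity : (0 : ℝ) ≤ c + K.index)]
      _ ≤ _ := le_mul_of_one_le_right (by positivity) hRF

/-- for a finite-index subgroup `K ≤ G`,
`RF_{K,P∩K,B_K} ⪯ RF_{G,P,B_G}`, and if every `N ∈ P` lies in `K`, then
`RF_{K,P∩K,B_K} ≈ RF_{G,P,B_G}`. -/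
theorem stmt_2 {G : Type*} [Group G] (S : Finset G)
    (hS : Subgroup.closure (S : Set G) = ⊤)
    (P : Set (Subgroup G)) (hP : P ⊆ nu G) (hsep : sInf P = ⊥)
    (K : Subgroup G) (hK : K.FiniteIndex)
    (T : Finset K) (hT : Subgroup.closure (T : Set K) = ⊤) :
    GrowthLE (RFgrowth ((fun N => N.subgroupOf K) '' P) T) (RFgrowth P S) ∧
    ((∀ N ∈ P, N ≤ K) →
      GrowthEquiv (RFgrowth ((fun N => N.subgroupOf K) '' P) T) (RFgrowth P S)) := by
  have hle := growthLE_RFgrowth_subgroupOf hS hP hsep K T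
  exact ⟨hle, fun hPK => ⟨hle, growthLE_RFgrowth_of_forall_le S hsep K hT hPK⟩⟩
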